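/- Let A be a unital C*-algebra and let T : A → A be a symmetric bounded linear map that is triple derivable at orthogonal pairs. Then T(1) is a self-adjoint central element of A, the map D : A → A defined by D(a) := T(a) − T(1)·a is a *-derivation, and T is a generalized derivation: T(ab) = T(a)·b + a·T(b) − a·T(1)·b for all a,b ∈ A. -/

import Mathlib

variable {A : Type*} [NormedRing A] [StarRing A] [CStarRing A]
  [NormedAlgebra ℂ A] [StarModule ℂ A] [CompleteSpace A]

/-- The triple product `{x,y,z} = (1/2)(x y* z + z y* x)` on a C*-algebra. -/
noncomputable def tp (x y z : A) : A := (2⁻¹ : ℂ) • (x * star y * z + z * star y * x)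

/-- Orthogonality: `a ⊥ b` iff `a b* = 0` and `b* a = 0`. -/
def Orthog (a b : A) : Prop := a * star b = 0 ∧ star b * a = 0

/-- A map is triple derivable at orthogonal pairs. -/
def TripleDerivableAtOrthPairs (T : A → A) : Prop :=
  ∀ a b c : A, Orthog a b →
    tp (T a) b c + tp a (T b) c + tp a b (T c) = 0

section JordanDerivation

variable {R : Type*} [Ring R]

theorem mul_mul_eq_zero_of_add_swap_eq_zero (h2 : ∀ x : R, x + x = 0 → x = 0)
    (hR : ∀ a : R, (∀ x, a * x * a = 0) → a = 0) {p q : R}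
    (h : ∀ x, p * x * q + q * x * p = 0) (x : R) : p * x * q = 0 := by
  refine hR _ fun y => h2 _ ?_
  have h₁ := congrArg (fun t => p * x * t * x * q) (h y)
  have h₂ := congrArg (fun t => t * x * q) (h (x * p * y))
  have h₃ := congrArg (fun t => t * y * (p * x * q)) (h x)
  simp only [mul_zero, zero_mul] at h₁ h₂ h₃
  linear_combination (norm := noncomm_ring) h₁ - h₂ + h₃

variable (D : R →+ R)

theorem jordan_map_mul_add_mul (hD : ∀ x, D (x * x) = D x * x + x * D x) (a b : R) :
    D (a * b + b * a) = D a * b + a * D b + D b * a + b * D a := by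
  have h := hD (a + b)
  have e : (a + b) * (a + b) = a * a + b * b + (a * b + b * a) := by noncomm_ring
  rw [e, map_add, map_add, hD a, hD b] at h
  simp only [map_add] at h ⊢
  linear_combination (norm := noncomm_ring) h

theorem jordan_map_mul_mul (h2 : ∀ x : R, x + x = 0 → x = 0)
    (hD : ∀ x, D (x * x) = D x * x + x * D x) (a b : R) :
    D (a * b * a) = D a * b * a + a * D b * a + a * b * D a := by
  have h₁ := jordan_map_mul_add_mul D hD a (a * b + b * a)
  have h₂ := jordan_map_mul_add_mul D hD (a * a) b
  have e : a * (a * b + b * a) + (a * b + b * a) * a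
      = (a * a * b + b * (a * a)) + (a * b * a + a * b * a) := by noncomm_ring
  rw [e, map_add, h₂, map_add D (a * b * a), jordan_map_mul_add_mul D hD a b, hD] at h₁
  refine sub_eq_zero.mp (h2 _ ?_)
  linear_combination (norm := noncomm_ring) h₁

theorem jordan_map_mul_mul_add (h2 : ∀ x : R, x + x = 0 → x = 0)
    (hD : ∀ x, D (x * x) = D x * x + x * D x) (a b c : R) :
    D (a * b * c + c * b * a) = D a * b * c + a * D b * c + a * b * D c
      + D c * b * a + c * D b * a + c * b * D a := by
  have h := jordan_map_mul_mul D h2 hD (a + c) b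
  have e : (a + c) * b * (a + c) = a * b * a + c * b * c + (a * b * c + c * b * a) := by
    noncomm_ring
  rw [e, map_add, map_add, jordan_map_mul_mul D h2 hD a b,
    jordan_map_mul_mul D h2 hD c b] at h
  simp only [map_add] at h ⊢
  linear_combination (norm := noncomm_ring) h

/-- The failure of an additive map to satisfy the Leibniz rule. -/
def leibnizDefect (a b : R) : R := D (a * b) - D a * b - a * D b

theorem leibnizDefect_add_left (a c b : R) :
    leibnizDefect D (a + c) b = leibnizDefect D a b + leibnizDefect D c b := by
  simp only [leibnizDefect, add_mul, map_add]
  abel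

theorem leibnizDefect_add_right (a b d : R) :
    leibnizDefect D a (b + d) = leibnizDefect D a b + leibnizDefect D a d := by
  simp only [leibnizDefect, mul_add, map_add]
  abel

theorem leibnizDefect_swap (hD : ∀ x, D (x * x) = D x * x + x * D x) (a b : R) :
    leibnizDefect D b a = -leibnizDefect D a b := by
  have h := jordan_map_mul_add_mul D hD a b
  rw [map_add] at h
  simp only [leibnizDefect]
  linear_combination (norm := noncomm_ring) h

theorem leibnizDefect_mul_commutator (h2 : ∀ x : R, x + x = 0 → x = 0)
    (hR : ∀ a : R, (∀ x, a * x * a = 0) → a = 0)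
    (hD : ∀ x, D (x * x) = D x * x + x * D x) (a b x : R) :
    leibnizDefect D a b * x * (a * b - b * a) = 0 := by
  refine mul_mul_eq_zero_of_add_swap_eq_zero h2 hR (fun x => ?_) x
  have h₁ := jordan_map_mul_mul_add D h2 hD (a * b) x (b * a)
  have e : a * b * x * (b * a) + b * a * x * (a * b)
      = a * (b * x * b) * a + b * (a * x * a) * b := by noncomm_ring
  rw [e, map_add, jordan_map_mul_mul D h2 hD a, jordan_map_mul_mul D h2 hD b,
    jordan_map_mul_mul D h2 hD b, jordan_map_mul_mul D h2 hD a] at h₁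
  have h₂ : D (b * a) = D a * b + a * D b + D b * a + b * D a - D (a * b) := by
    rw [← jordan_map_mul_add_mul D hD a b, map_add]; abel
  rw [h₂] at h₁
  simp only [leibnizDefect]
  linear_combination (norm := noncomm_ring) h₁

theorem leibnizDefect_mul_commutator' (h2 : ∀ x : R, x + x = 0 → x = 0)
    (hR : ∀ a : R, (∀ x, a * x * a = 0) → a = 0)
    (hD : ∀ x, D (x * x) = D x * x + x * D x) (a b c d x : R) :
    leibnizDefect D a b * x * (c * d - d * c) = 0 := by
  have swap : ∀ {p q : R}, (∀ x, p * x * q = 0) → ∀ y, q * y * p = 0 := by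
    intro p q h y
    refine hR _ fun z => ?_
    calc q * y * p * z * (q * y * p) = q * y * (p * z * q) * y * p := by noncomm_ring
      _ = 0 := by rw [h]; simp
  have key : ∀ a b c x : R, leibnizDefect D a b * x * (c * b - b * c) = 0 := by
    intro a b c x
    refine hR _ fun y => ?_
    have h₀ := leibnizDefect_mul_commutator D h2 hR hD
    have h₁ := h₀ (a + c) b x
    rw [leibnizDefect_add_left] at h₁
    have h₂ : leibnizDefect D a b * x * (c * b - b * c)
        = - (leibnizDefect D c b * x * (a * b - b * a)) := by
      linear_combination (norm := noncomm_ring) h₁ - h₀ a b x - h₀ c b x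
    nth_rw 2 [h₂]
    calc _ = -(leibnizDefect D a b * x * ((c * b - b * c) * y * leibnizDefect D c b) * x
          * (a * b - b * a)) := by noncomm_ring
      _ = 0 := by rw [swap (h₀ c b)]; simp
  refine hR _ fun y => ?_
  have h₁ := key a (b + d) c x
  rw [leibnizDefect_add_right] at h₁
  have h₂ : leibnizDefect D a b * x * (c * d - d * c)
      = - (leibnizDefect D a d * x * (c * b - b * c)) := by
    linear_combination (norm := noncomm_ring) h₁ - key a b c x - key a d c x
  nth_rw 2 [h₂]
  calc _ = -(leibnizDefect D a b * x * ((c * d - d * c) * y * leibnizDefect D a d) * x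
        * (c * b - b * c)) := by noncomm_ring
    _ = 0 := by rw [swap (key a d c)]; simp

/-- A Jordan derivation of a 2-torsion-free semiprime ring is a derivation. -/
theorem jordan_derivation_map_mul (h2 : ∀ x : R, x + x = 0 → x = 0)
    (hR : ∀ a : R, (∀ x, a * x * a = 0) → a = 0)
    (hD : ∀ x, D (x * x) = D x * x + x * D x) (a b : R) :
    D (a * b) = D a * b + a * D b := by
  obtain ⟨w, hw⟩ : ∃ w, w = leibnizDefect D a b := ⟨_, rfl⟩
  have h₀ : ∀ x c d, w * x * (c * d - d * c) = 0 := fun x c d =>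
    hw ▸ leibnizDefect_mul_commutator' D h2 hR hD a b c d x
  have hc : ∀ c, w * c = c * w := by
    intro c
    refine sub_eq_zero.mp (hR _ fun x => ?_)
    linear_combination (norm := noncomm_ring) h₀ (c * x) w c - c * h₀ x w c
  have h₁ : w * (a * b - b * a) = 0 := by simpa using h₀ 1 a b
  have h₂ : D (a * b - b * a) = w + w + (D a * b - b * D a) + (a * D b - D b * a) := by
    have := leibnizDefect_swap D hD a b
    rw [← hw] at this
    simp only [leibnizDefect] at this hw
    rw [map_sub]
    linear_combination (norm := noncomm_ring) -hw - this
  have h₃ := jordan_map_mul_add_mul D hD w (a * b - b * a)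
  rw [← hc, h₁, add_zero, map_zero, h₂] at h₃
  have h₄ : w * (w + w + (D a * b - b * D a) + (a * D b - D b * a)) = w * w + w * w := by
    linear_combination (norm := noncomm_ring) h₀ 1 (D a) b + h₀ 1 a (D b)
  rw [← hc (_ + _), h₄] at h₃
  have hk : w * w * w = 0 := by
    refine h2 _ (h2 _ ?_)
    linear_combination (norm := noncomm_ring) -(w * h₃) - h₀ (D w) a b - h₁ * D w
  have hk₂ : w * w = 0 := hR _ fun x => by
    calc w * w * x * (w * w) = w * w * (x * w) * w := by noncomm_ring
      _ = 0 := by rw [← hc x, ← mul_assoc (w * w), hk]; simp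
  have hw0 : w = 0 := hR _ fun x => by rw [mul_assoc, ← hc x, ← mul_assoc, hk₂, zero_mul]
  rw [hw0] at hw
  simp only [leibnizDefect] at hw
  linear_combination (norm := noncomm_ring) -hw

end JordanDerivation

section Ramp

/-- The continuous step of height one which increases on `[-1/6, 1/6]`. -/
noncomputable def ramp (y : ℝ) : ℝ := max 0 (min 1 (3 * y + 1 / 2))

theorem continuous_ramp : Continuous ramp := by unfold ramp; fun_prop

theorem ramp_of_le {y : ℝ} (hy : y ≤ -(1 / 6)) : ramp y = 0 :=
  max_eq_left ((min_le_right _ _).trans (by linarith))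

theorem ramp_of_ge {y : ℝ} (hy : 1 / 6 ≤ y) : ramp y = 1 := by
  rw [ramp, min_eq_left (by linarith), max_eq_right zero_le_one]

theorem sum_ramp_of_ge {x : ℝ} {m : ℕ} (hx : m - 1 / 2 ≤ x) :
    ∑ n ∈ Finset.range m, ramp (x - n) = m := by
  rw [Finset.sum_congr rfl (g := fun _ => (1 : ℝ))]
  · simp
  · intro n hn
    have : (n : ℝ) + 1 ≤ m := by exact_mod_cast Finset.mem_range.mp hn
    exact ramp_of_ge (by linarith)

theorem abs_sum_ramp_sub_le {x : ℝ} (hx : 0 ≤ x) {m : ℕ} (hm : x ≤ m - 1 / 2) :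
    |∑ n ∈ Finset.range m, ramp (x - n) - x| ≤ 3 / 2 := by
  induction m with
  | zero => norm_num at hm; linarith
  | succ m ih =>
    push_cast at hm
    rw [Finset.sum_range_succ]
    rcases le_total x (m - 1 / 2) with h | h
    · rw [ramp_of_le (by linarith), add_zero]
      exact ih h
    · rw [sum_ramp_of_ge h, abs_le]
      have h₀ : 0 ≤ ramp (x - m) := le_max_left _ _
      have h₁ : ramp (x - m) ≤ 1 := max_le zero_le_one (min_le_left _ _)
      constructor <;> linarith

theorem half_le_cos_of_abs_sub_le {x : ℝ} {n : ℤ} (h : |x - n| ≤ 1 / 6) :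
    1 / 2 ≤ Real.cos (2 * Real.pi * x) := by
  have e : Real.cos (2 * Real.pi * x) = Real.cos |2 * Real.pi * (x - n)| := by
    rw [Real.cos_abs, ← Real.cos_sub_int_mul_two_pi _ n]
    congr 1; ring
  rw [e, ← Real.cos_pi_div_three, abs_mul, abs_of_pos Real.two_pi_pos]
  have := Real.pi_pos
  exact Real.cos_le_cos_of_nonneg_of_le_pi (by positivity) (by linarith) (by nlinarith)

theorem ramp_mul_one_sub_ramp {x : ℝ} {n : ℕ} (h : Real.cos (2 * Real.pi * x) < 1 / 2) :
    ramp (x - n) * (1 - ramp (x - n)) = 0 := by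
  have h' : 1 / 6 < |x - n| := by
    by_contra! hle
    exact h.not_ge (half_le_cos_of_abs_sub_le (n := n) (by exact_mod_cast hle))
  rcases lt_abs.mp h' with h' | h'
  · rw [ramp_of_ge h'.le]; ring
  · rw [ramp_of_le (by linarith)]; ring

end Ramp

section OrthogonalForm

variable {K E : Type*} [TopologicalSpace K]
  [NormedAddCommGroup E] [NormedSpace ℝ E] (V : C(K, ℝ) →ₗ[ℝ] C(K, ℝ) →ₗ[ℝ] E)

theorem orthogonal_form_apply_of_mul_eq_zero (hV : ∀ f g, f * g = 0 → V f g = 0)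
    {s g : C(K, ℝ)} (h : g * (s * (1 - s)) = 0) : V s g = V 1 (s * g) := by
  have h₁ := hV s (g * (1 - s)) (by rw [← h]; ring)
  have h₂ := hV (1 - s) (g * s) (by rw [← h]; ring)
  have e : g * (1 - s) = g - g * s := by ring
  rw [e, map_sub] at h₁
  rw [map_sub, LinearMap.sub_apply] at h₂
  rw [mul_comm s g, sub_eq_zero.mp h₁, sub_eq_zero.mp h₂]

theorem norm_orthogonal_form_sub_le_of_cos [CompactSpace K] {C : ℝ} (hC₀ : 0 ≤ C)
    (hC : ∀ f g, ‖V f g‖ ≤ C * ‖f‖ * ‖g‖) (hV : ∀ f g, f * g = 0 → V f g = 0)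
    {F g : C(K, ℝ)} (hF : ∀ k, 0 ≤ F k)
    (hg : ∀ k, 1 / 2 ≤ Real.cos (2 * Real.pi * F k) → g k = 0) :
    ‖V F g - V 1 (F * g)‖ ≤ 3 * C * ‖g‖ := by
  let S : ℕ → C(K, ℝ) := fun n => ⟨fun k => ramp (F k - n), continuous_ramp.comp (by fun_prop)⟩
  have hS : ∀ n, V (S n) g = V 1 (S n * g) := fun n => by
    refine orthogonal_form_apply_of_mul_eq_zero V hV (ContinuousMap.ext fun k => ?_)
    rcases le_or_gt (1 / 2) (Real.cos (2 * Real.pi * F k)) with h | h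
    · simp [hg k h]
    · have := ramp_mul_one_sub_ramp (n := n) h
      simpa [S] using Or.inr (mul_eq_zero.mp this)
  obtain ⟨m, hm⟩ := exists_nat_ge (‖F‖ + 1 / 2)
  obtain ⟨Q, hQ⟩ : ∃ Q, Q = ∑ n ∈ Finset.range m, S n := ⟨_, rfl⟩
  have hVQ : V Q g = V 1 (Q * g) := by
    rw [hQ, map_sum, LinearMap.sum_apply, Finset.sum_mul, map_sum]
    exact Finset.sum_congr rfl fun n _ => hS n
  have hFQ : ‖F - Q‖ ≤ 3 / 2 := by
    refine (ContinuousMap.norm_le _ (by norm_num)).mpr fun k => ?_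
    have hk : F k ≤ m - 1 / 2 := by
      linarith [(le_abs_self _).trans (ContinuousMap.norm_coe_le_norm F k)]
    have := abs_sum_ramp_sub_le (hF k) hk
    rw [abs_sub_comm] at this
    simpa [hQ, S, ContinuousMap.sum_apply] using this
  have h1 : ‖(1 : C(K, ℝ))‖ ≤ 1 := (ContinuousMap.norm_le _ zero_le_one).mpr fun k => by simp
  have e : V F g - V 1 (F * g) = V (F - Q) g - V 1 ((F - Q) * g) := by
    rw [sub_mul, map_sub, map_sub, LinearMap.sub_apply, hVQ]; abel
  rw [e]
  calc ‖V (F - Q) g - V 1 ((F - Q) * g)‖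
      ≤ ‖V (F - Q) g‖ + ‖V 1 ((F - Q) * g)‖ := norm_sub_le _ _
    _ ≤ C * ‖F - Q‖ * ‖g‖ + C * ‖(1 : C(K, ℝ))‖ * ‖(F - Q) * g‖ :=
        add_le_add (hC _ _) (hC _ _)
    _ ≤ C * (3 / 2) * ‖g‖ + C * 1 * ((3 / 2) * ‖g‖) := by
        have := (norm_mul_le (F - Q) g).trans (mul_le_mul_of_nonneg_right hFQ (norm_nonneg g))
        gcongr
    _ = 3 * C * ‖g‖ := by ring

theorem orthogonal_form_add_smul_one (F g : C(K, ℝ)) (c : ℝ) :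
    V (F + c • 1) g - V 1 ((F + c • 1) * g) = V F g - V 1 (F * g) := by
  simp [add_mul]

theorem norm_orthogonal_form_sub_le [CompactSpace K] {C : ℝ} (hC₀ : 0 ≤ C)
    (hC : ∀ f g, ‖V f g‖ ≤ C * ‖f‖ * ‖g‖) (hV : ∀ f g, f * g = 0 → V f g = 0)
    {F : C(K, ℝ)} (hF : ∀ k, 0 ≤ F k) (g : C(K, ℝ)) :
    ‖V F g - V 1 (F * g)‖ ≤ 6 * C * ‖g‖ := by
  let w : C(K, ℝ) :=
    ⟨fun k => max 0 (min 1 (1 / 2 - Real.cos (2 * Real.pi * F k))), by fun_prop⟩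
  have hw : ∀ k, w k = max 0 (min 1 (1 / 2 - Real.cos (2 * Real.pi * F k))) := fun _ => rfl
  have hw0 : ∀ k, 0 ≤ w k := fun k => le_max_left _ _
  have hw1 : ∀ k, w k ≤ 1 := fun k => max_le zero_le_one (min_le_left _ _)
  have bound : ∀ u : C(K, ℝ), ‖u‖ ≤ 1 → 3 * C * ‖g * u‖ ≤ 3 * C * ‖g‖ := fun u hu => by
    have := (norm_mul_le g u).trans (mul_le_of_le_one_right (norm_nonneg g) hu)
    gcongr
  have hwn : ‖w‖ ≤ 1 := (ContinuousMap.norm_le _ zero_le_one).mpr fun k => by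
    rw [Real.norm_eq_abs, abs_le]; constructor <;> linarith [hw0 k, hw1 k]
  have hwn' : ‖1 - w‖ ≤ 1 := (ContinuousMap.norm_le _ zero_le_one).mpr fun k => by
    rw [Real.norm_eq_abs, abs_le, ContinuousMap.sub_apply, ContinuousMap.one_apply]
    constructor <;> linarith [hw0 k, hw1 k]
  have h₁ : ‖V F (g * w) - V 1 (F * (g * w))‖ ≤ 3 * C * ‖g‖ := by
    refine (norm_orthogonal_form_sub_le_of_cos V hC₀ hC hV hF fun k hk => ?_).trans (bound w hwn)
    rw [ContinuousMap.mul_apply, hw, max_eq_left ((min_le_right _ _).trans (by linarith)),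
      mul_zero]
  have h₂ : ‖V F (g * (1 - w)) - V 1 (F * (g * (1 - w)))‖ ≤ 3 * C * ‖g‖ := by
    rw [← orthogonal_form_add_smul_one V F _ (1 / 2)]
    refine (norm_orthogonal_form_sub_le_of_cos V hC₀ hC hV (fun k => ?_) fun k hk => ?_).trans
      (bound _ hwn')
    · have := hF k
      simp only [ContinuousMap.add_apply, ContinuousMap.smul_apply, ContinuousMap.one_apply,
        smul_eq_mul]
      linarith
    · have e : 2 * Real.pi * (F + (1 / 2 : ℝ) • (1 : C(K, ℝ))) k
          = 2 * Real.pi * F k + Real.pi := by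
        simp only [ContinuousMap.add_apply, ContinuousMap.smul_apply, ContinuousMap.one_apply,
          smul_eq_mul]
        ring
      rw [e, Real.cos_add_pi] at hk
      rw [ContinuousMap.mul_apply, ContinuousMap.sub_apply, ContinuousMap.one_apply, hw,
        min_eq_left (by linarith), max_eq_right zero_le_one, sub_self, mul_zero]
  have e : V F g - V 1 (F * g) = (V F (g * w) - V 1 (F * (g * w)))
      + (V F (g * (1 - w)) - V 1 (F * (g * (1 - w)))) := by
    rw [mul_sub, mul_one, mul_sub, map_sub, map_sub]; abel
  rw [e]
  linarith [norm_add_le (V F (g * w) - V 1 (F * (g * w)))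
    (V F (g * (1 - w)) - V 1 (F * (g * (1 - w))))]

/-- A bounded bilinear map on `C(K, ℝ)` vanishing on pairs with zero product factors through
the product. -/
theorem orthogonal_form_apply [CompactSpace K] {C : ℝ} (hC₀ : 0 ≤ C)
    (hC : ∀ f g, ‖V f g‖ ≤ C * ‖f‖ * ‖g‖) (hV : ∀ f g, f * g = 0 → V f g = 0) (f g : C(K, ℝ)) :
    V f g = V 1 (f * g) := by
  have key : ∀ N : ℕ, N * ‖V f g - V 1 (f * g)‖ ≤ 6 * C * ‖g‖ := fun N => by
    have h := norm_orthogonal_form_sub_le V hC₀ hC hV (F := (N : ℝ) • (f + ‖f‖ • 1)) (fun k => by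
      have := (neg_le_abs _).trans (ContinuousMap.norm_coe_le_norm f k)
      simp only [ContinuousMap.add_apply, ContinuousMap.smul_apply, ContinuousMap.one_apply,
        smul_eq_mul]
      exact mul_nonneg N.cast_nonneg (by linarith)) g
    rw [smul_mul_assoc, map_smul, map_smul, LinearMap.smul_apply, ← smul_sub,
      orthogonal_form_add_smul_one, norm_smul] at h
    simpa using h
  by_contra hne
  have hpos : 0 < ‖V f g - V 1 (f * g)‖ := norm_pos_iff.mpr (sub_ne_zero.mpr hne)
  obtain ⟨N, hN⟩ := exists_nat_gt (6 * C * ‖g‖ / ‖V f g - V 1 (f * g)‖)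
  rw [div_lt_iff₀ hpos] at hN
  linarith [key N]

end OrthogonalForm

section Orthogonality

theorem orthogonal_sum_eq_zero {R : Type*} [Ring R] (h2 : ∀ x : R, x + x = 0 → x = 0)
    (hR : ∀ a : R, (∀ x, a * x * a = 0) → a = 0) {a d u e : R} (had : a * d = 0)
    (hda : d * a = 0) (h : ∀ c, (u * d + a * e) * c + c * (d * u + e * a) = 0) :
    u * d + a * e = 0 := by
  obtain ⟨p, hp⟩ : ∃ p, p = u * d + a * e := ⟨_, rfl⟩
  obtain ⟨q, hq⟩ : ∃ q, q = d * u + e * a := ⟨_, rfl⟩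
  rw [← hp, ← hq] at h
  rw [← hp]
  have hqp : q = -p := by
    have := h 1
    rw [mul_one, one_mul] at this
    exact eq_neg_of_add_eq_zero_right this
  have hc : ∀ c, p * c = c * p := fun c => by
    have := h c
    rwa [hqp, mul_neg, add_neg_eq_zero] at this
  have hpa : p * a = 0 := by
    have h₁ : p * a = a * q := by
      rw [hp, hq]
      linear_combination (norm := noncomm_ring) u * hda - had * u
    refine h2 _ ?_
    nth_rw 2 [h₁]
    rw [hqp, hc, mul_neg, add_neg_cancel]
  have hpd : p * d = 0 := by
    have h₁ : d * p = q * d := by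
      rw [hp, hq]
      linear_combination (norm := noncomm_ring) hda * e - e * had
    refine h2 _ ?_
    nth_rw 1 [hc]
    rw [h₁, hqp, neg_mul, neg_add_cancel]
  have hpp : p * p = 0 := by
    nth_rw 2 [hp]
    rw [mul_add, ← mul_assoc, ← mul_assoc, hpa, hc, mul_assoc, hpd, mul_zero, zero_mul, add_zero]
  exact hR _ fun x => by rw [hc, mul_assoc, hpp, mul_zero]

end Orthogonality

section CStar

variable {B : Type*} [CStarAlgebra B]

theorem CStarRing.eq_zero_of_mul_mul_self {a : B} (h : ∀ x, a * x * a = 0) : a = 0 := by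
  have h₁ : star (star a * a) * (star a * a) = 0 := by
    rw [star_mul, star_star, mul_assoc, ← mul_assoc a, h, mul_zero]
  exact CStarRing.star_mul_self_eq_zero_iff a |>.mp
    (CStarRing.star_mul_self_eq_zero_iff _ |>.mp h₁)

theorem eq_zero_of_add_self_complex {x : B} (h : x + x = 0) : x = 0 := by
  rw [← two_smul ℂ] at h
  exact (smul_eq_zero.mp h).resolve_left two_ne_zero

theorem orthogonal_form_apply_self {E : Type*} [NormedAddCommGroup E] [NormedSpace ℝ E]
    (V : B →ₗ[ℝ] B →ₗ[ℝ] E) {C : ℝ} (hC₀ : 0 ≤ C) (hC : ∀ f g, ‖V f g‖ ≤ C * ‖f‖ * ‖g‖)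
    (hV : ∀ f g, IsSelfAdjoint f → IsSelfAdjoint g → f * g = 0 → g * f = 0 → V f g = 0)
    {h : B} (hh : IsSelfAdjoint h) : V h h = V 1 (h * h) := by
  let φ : C(spectrum ℝ h, ℝ) →⋆ₐ[ℝ] B := cfcHom hh
  let L : C(spectrum ℝ h, ℝ) →ₗ[ℝ] B := φ.toAlgHom.toLinearMap
  have hL : ∀ f, L f = φ f := fun _ => rfl
  have hn : ∀ f, ‖φ f‖ = ‖f‖ := fun f => norm_cfcHom h f hh
  have hsa : ∀ f, IsSelfAdjoint (φ f) := fun f => by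
    rw [IsSelfAdjoint, ← map_star]
    congr 1
  have key := orthogonal_form_apply (V.compl₁₂ L L) hC₀
    (fun f g => by simpa [hL, hn] using hC (φ f) (φ g))
    (fun f g hfg => by
      refine hV _ _ (hsa f) (hsa g) ?_ ?_
      · rw [hL, hL, ← map_mul, hfg, map_zero]
      · rw [hL, hL, ← map_mul, mul_comm, hfg, map_zero])
    ((ContinuousMap.id ℝ).restrict _) ((ContinuousMap.id ℝ).restrict _)
  simpa [hL, φ, cfcHom_id hh] using key

theorem map_mul_self_of_orthogonal (T : B →L[ℂ] B)
    (hT : ∀ f g, IsSelfAdjoint f → IsSelfAdjoint g → f * g = 0 → g * f = 0 →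
      T f * g + f * T g = 0) {h : B} (hh : IsSelfAdjoint h) :
    T h * h + h * T h = T 1 * (h * h) + T (h * h) ∧
      T h * h + h * T h = h * h * T 1 + T (h * h) := by
  let S : B →ₗ[ℝ] B := T.toLinearMap.restrictScalars ℝ
  have hS : ∀ x, S x = T x := fun _ => rfl
  have bound : ∀ f g : B, ‖T f‖ * ‖g‖ + ‖f‖ * ‖T g‖ ≤ 2 * ‖T‖ * ‖f‖ * ‖g‖ := fun f g => by
    have h₁ := mul_le_mul_of_nonneg_right (T.le_opNorm f) (norm_nonneg g)
    have h₂ := mul_le_mul_of_nonneg_left (T.le_opNorm g) (norm_nonneg f)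
    linarith
  constructor
  · have := orthogonal_form_apply_self
      ((LinearMap.mul ℝ B).compl₁₂ S LinearMap.id + (LinearMap.mul ℝ B).compl₁₂ LinearMap.id S)
      (C := 2 * ‖T‖) (by positivity)
      (fun f g => (norm_add_le _ _).trans <|
        (add_le_add (norm_mul_le _ _) (norm_mul_le _ _)).trans (bound f g))
      (fun f g hf hg hfg hgf => hT f g hf hg hfg hgf) hh
    simpa [hS] using this
  · have := orthogonal_form_apply_self
      ((LinearMap.mul ℝ B).flip.compl₁₂ S LinearMap.id +
        (LinearMap.mul ℝ B).flip.compl₁₂ LinearMap.id S)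
      (C := 2 * ‖T‖) (by positivity)
      (fun f g => (norm_add_le _ _).trans <|
        (add_le_add (norm_mul_le _ _) (norm_mul_le _ _)).trans
          (by rw [mul_comm, mul_comm ‖S g‖]; exact bound f g))
      (fun f g hf hg hfg hgf => by
        have := hT g f hg hf hgf hfg
        rw [add_comm] at this
        exact this) hh
    rw [add_comm (T h * h)]
    simpa [hS] using this

/-- A bounded linear map which is a derivation at orthogonal self-adjoint pairs is a
derivation plus multiplication by a central element. -/
theorem central_and_derivation_of_orthogonal (T : B →L[ℂ] B)
    (hT : ∀ f g, IsSelfAdjoint f → IsSelfAdjoint g → f * g = 0 → g * f = 0 →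
      T f * g + f * T g = 0) :
    (∀ x, T 1 * x = x * T 1) ∧
      ∀ x y, T (x * y) - T 1 * (x * y) = (T x - T 1 * x) * y + x * (T y - T 1 * y) := by
  have hsq : ∀ h : B, IsSelfAdjoint h → T 1 * (h * h) = h * h * T 1 := fun h hh => by
    obtain ⟨h₁, h₂⟩ := map_mul_self_of_orthogonal T hT hh
    exact add_right_cancel (h₁.symm.trans h₂)
  have hsa : ∀ h : B, IsSelfAdjoint h → T 1 * h = h * T 1 := fun h hh => by
    refine sub_eq_zero.mp (eq_zero_of_add_self_complex ?_)
    linear_combination (norm := noncomm_ring)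
      hsq (h + 1) (hh.add (IsSelfAdjoint.one B)) - hsq h hh
  have hdec : ∀ x : B, ∃ a b : B, IsSelfAdjoint a ∧ IsSelfAdjoint b ∧ x = a + Complex.I • b :=
    fun x => ⟨realPart x, imaginaryPart x, (realPart x).2, (imaginaryPart x).2,
      (realPart_add_I_smul_imaginaryPart x).symm⟩
  have hc : ∀ x, T 1 * x = x * T 1 := fun x => by
    obtain ⟨a, b, ha, hb, rfl⟩ := hdec x
    rw [mul_add, add_mul, hsa a ha, mul_smul_comm, hsa b hb, smul_mul_assoc]
  refine ⟨hc, ?_⟩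
  let D : B →ₗ[ℂ] B := T.toLinearMap - LinearMap.mulLeft ℂ (T 1)
  have hDT : ∀ x, D x = T x - T 1 * x := fun _ => rfl
  have hD : ∀ h, IsSelfAdjoint h → D (h * h) = D h * h + h * D h := fun h hh => by
    rw [hDT, hDT]
    linear_combination (norm := noncomm_ring)
      -(map_mul_self_of_orthogonal T hT hh).1 - hc h * h
  have hD₂ : ∀ a b, IsSelfAdjoint a → IsSelfAdjoint b →
      D (a * b) + D (b * a) = D a * b + a * D b + D b * a + b * D a := fun a b ha hb => by
    have h := hD (a + b) (ha.add hb)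
    have e : (a + b) * (a + b) = a * a + b * b + (a * b + b * a) := by noncomm_ring
    rw [e, map_add, map_add, hD a ha, hD b hb, map_add, map_add] at h
    linear_combination (norm := noncomm_ring) h
  have hJ : ∀ x, D (x * x) = D x * x + x * D x := fun x => by
    obtain ⟨a, b, ha, hb, rfl⟩ := hdec x
    have e : (a + Complex.I • b) * (a + Complex.I • b)
        = a * a - b * b + Complex.I • (a * b + b * a) := by
      simp only [mul_add, add_mul, mul_smul_comm, smul_mul_assoc, smul_add, smul_smul,
        Complex.I_mul_I, neg_smul, one_smul]
      abel
    rw [e, map_add, map_sub, map_smul, map_add, hD a ha, hD b hb, hD₂ a b ha hb, map_add,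
      map_smul]
    simp only [mul_add, add_mul, mul_smul_comm, smul_mul_assoc, smul_add, smul_smul,
      Complex.I_mul_I, neg_smul, one_smul]
    abel
  exact jordan_derivation_map_mul D.toAddMonoidHom (fun _ => eq_zero_of_add_self_complex)
    (fun _ => CStarRing.eq_zero_of_mul_mul_self) hJ

end CStar

theorem TripleDerivableAtOrthPairs.add_eq_zero {T : A → A} (hT : TripleDerivableAtOrthPairs T)
    {a b : A} (hab : Orthog a b) : T a * star b + a * star (T b) = 0 := by
  let _ : CStarAlgebra A := {}
  refine orthogonal_sum_eq_zero (fun _ => eq_zero_of_add_self_complex)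
    (fun _ => CStarRing.eq_zero_of_mul_mul_self) hab.1 hab.2 fun c => ?_
  have h := hT a b c hab
  simp only [tp, ← smul_add] at h
  have h' := (smul_eq_zero.mp h).resolve_left (by norm_num)
  linear_combination (norm := noncomm_ring) h' - hab.1 * T c - T c * hab.2

/-- a symmetric bounded linear map on a unital C*-algebra which is triple
derivable at orthogonal pairs satisfies: `T 1` is a self-adjoint central element,
`D a := T a - T 1 * a` is a `*`-derivation, and `T` is a generalized derivation. -/
theorem stmt2 (T : A →L[ℂ] A)
    (hsym : ∀ x : A, star (T (star x)) = T x)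
    (hT : TripleDerivableAtOrthPairs (T : A → A)) :
    IsSelfAdjoint (T 1) ∧ (∀ x : A, T 1 * x = x * T 1) ∧
    (∀ x y : A, (T (x * y) - T 1 * (x * y)) =
        (T x - T 1 * x) * y + x * (T y - T 1 * y)) ∧
    (∀ x : A, T (star x) - T 1 * star x = star (T x - T 1 * x)) ∧
    (∀ a b : A, T (a * b) = T a * b + a * T b - a * T 1 * b) := by
  let _ : CStarAlgebra A := {}
  have hstar : ∀ x, T (star x) = star (T x) := fun x => by rw [← hsym x, star_star]
  have h1 : IsSelfAdjoint (T 1) := by rw [IsSelfAdjoint, ← hstar, star_one]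
  obtain ⟨hc, hD⟩ := central_and_derivation_of_orthogonal T fun f g _ hg hfg hgf => by
    have := hT.add_eq_zero (a := f) (b := g) (by
      rw [Orthog, hg.star_eq]; exact ⟨hfg, hgf⟩)
    rwa [← hstar, hg.star_eq] at this
  refine ⟨h1, hc, hD, fun x => ?_, fun a b => ?_⟩
  · rw [star_sub, star_mul, hstar, h1.star_eq, hc]
  · linear_combination (norm := noncomm_ring) hD a b + hc a * b - hc a * b
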